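/- arXiv:1905.10034 — 3 statements merged into one kernel-verified Lean document; each statement's English description precedes it below -/
import Mathlib

section
/- Let N be Binomial(M, p) with M = n^{1+α}, and I the interval of integers within one standard deviation √(Mp(1−p)) of Mp. Then for n large enough, |Mp − E(N | N ∈ I)| ≤ 3 / ((2π)^{−1/2} ∫_{−1}^{1} e^{−x²/2} dx). -/
open MeasureTheory Real Set

/-- The binomial weight. -/
noncomputable def bw (M : ℕ) (p : ℝ) (k : ℕ) : ℝ :=
  (M.choose k : ℝ) * p ^ k * (1 - p) ^ (M - k)

/-- The weight `k q b(k)`, whose telescoping differences are `(Mp - k) b(k)`. -/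
noncomputable def gw (M : ℕ) (p : ℝ) (k : ℕ) : ℝ := (k : ℝ) * (1 - p) * bw M p k

lemma bw_pos {M : ℕ} {p : ℝ} (h0 : 0 < p) (h1 : p < 1) {k : ℕ} (hk : k ≤ M) : 0 < bw M p k := by
  have h2 : 0 < 1 - p := by linarith
  have h3 : (0:ℝ) < (M.choose k : ℝ) := by exact_mod_cast Nat.choose_pos hk
  unfold bw
  positivity

lemma gw_succ {M : ℕ} {p : ℝ} {k : ℕ} (hk : k < M) :
    gw M p (k + 1) = ((M : ℝ) - k) * p * bw M p k := by
  have h := Nat.choose_succ_right_eq M k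
  have h' : (M.choose (k + 1) : ℝ) * ((k : ℝ) + 1) = M.choose k * ((M : ℝ) - k) := by
    rw [← Nat.cast_sub hk.le]; exact_mod_cast h
  obtain ⟨d, rfl⟩ : ∃ d, M = k + 1 + d := ⟨M - (k + 1), by omega⟩
  have e1 : k + 1 + d - (k + 1) = d := by omega
  have e2 : k + 1 + d - k = d + 1 := by omega
  unfold gw bw
  rw [e1, e2]
  push_cast at h' ⊢
  linear_combination (p ^ (k + 1) * (1 - p) ^ (d + 1)) * h'

lemma gw_sub {M : ℕ} {p : ℝ} {k : ℕ} (hk : k < M) :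
    ((k : ℝ) - M * p) * bw M p k = gw M p k - gw M p (k + 1) := by
  rw [gw_succ hk]; unfold gw; ring

lemma log_two_sided {x : ℝ} (hx : |x| ≤ 1 / 100) :
    x - 1.02 * x ^ 2 ≤ log (1 + x) ∧ log (1 + x) ≤ x := by
  obtain ⟨h1, h2⟩ := abs_le.mp hx
  have hp : 0 < 1 + x := by linarith
  constructor
  · have h := Real.one_sub_inv_le_log_of_pos hp
    have : x - 1.02 * x ^ 2 ≤ 1 - (1 + x)⁻¹ := by
      have e : 1 - (1 + x)⁻¹ = x / (1 + x) := by field_simp; ring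
      rw [e, le_div_iff₀ hp]
      nlinarith [sq_nonneg x]
    linarith
  · have := Real.log_le_sub_one_of_pos hp
    linarith

lemma step_bound {M : ℕ} {p s : ℝ} (h0 : 0 < p) (h1 : p < 1) (hs : 100 ≤ s)
    (hsq : s ^ 2 = M * p * (1 - p)) {k : ℕ} (hk1 : M * p - s < k) (hk2 : (k : ℝ) < M * p + s) :
    k < M ∧ 0 < k ∧
    |log (gw M p (k + 1)) - log (gw M p k) + ((k : ℝ) - M * p) / s ^ 2| ≤ 1.02 / s ^ 2 := by
  have hq : 0 < 1 - p := by linarith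
  have hs2 : 0 < s ^ 2 := by positivity
  have hMp : s ^ 2 ≤ M * p := by rw [hsq]; nlinarith [mul_nonneg (Nat.cast_nonneg (α := ℝ) M) h0.le]
  have hMq : s ^ 2 ≤ M * (1 - p) := by
    rw [hsq]; nlinarith [mul_nonneg (Nat.cast_nonneg (α := ℝ) M) hq.le]
  have hkM : k < M := by
    have : (k : ℝ) < M := by nlinarith
    exact_mod_cast this
  have hk0 : 0 < k := by
    have : (0 : ℝ) < k := by nlinarith
    exact_mod_cast this
  refine ⟨hkM, hk0, ?_⟩
  have hb := bw_pos h0 h1 hkM.le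
  set j : ℝ := (k : ℝ) - M * p with hj
  have hj1 : |j| ≤ s := abs_le.mpr ⟨by linarith, by linarith⟩
  have hj2 : j ^ 2 ≤ s ^ 2 := sq_le_sq' (by linarith) (by linarith)
  have key : ∀ t : ℝ, |t| ≤ 1 → |j * t / s ^ 2| ≤ 1 / 100 ∧ (j * t / s ^ 2) ^ 2 ≤ 1 / s ^ 2 := by
    intro t ht
    have ht2 : t ^ 2 ≤ 1 := by
      have := abs_le.mp ht; nlinarith
    constructor
    · rw [abs_div, abs_mul, abs_of_pos hs2, div_le_iff₀ hs2]
      have : |j| * |t| ≤ s * 1 := mul_le_mul hj1 ht (abs_nonneg _) (by linarith)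
      nlinarith
    · rw [div_pow, div_le_div_iff₀ (by positivity) hs2]
      have : j ^ 2 * t ^ 2 ≤ s ^ 2 * 1 := mul_le_mul hj2 ht2 (sq_nonneg _) hs2.le
      nlinarith
  obtain ⟨u1, u2⟩ := key (-p) (abs_le.mpr ⟨by linarith, by linarith⟩)
  obtain ⟨v1, v2⟩ := key (1 - p) (abs_le.mpr ⟨by linarith, by linarith⟩)
  have eu : ((M : ℝ) - k) * p = s ^ 2 * (1 + j * (-p) / s ^ 2) := by
    field_simp; rw [hsq, hj]; ring
  have ev : (k : ℝ) * (1 - p) = s ^ 2 * (1 + j * (1 - p) / s ^ 2) := by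
    field_simp; rw [hsq, hj]; ring
  have pu : 0 < 1 + j * (-p) / s ^ 2 := by linarith [(abs_le.mp u1).1]
  have pv : 0 < 1 + j * (1 - p) / s ^ 2 := by linarith [(abs_le.mp v1).1]
  rw [gw_succ hkM, gw, eu, ev, log_mul (by positivity) hb.ne', log_mul (by positivity) hb.ne',
    log_mul hs2.ne' pu.ne', log_mul hs2.ne' pv.ne']
  obtain ⟨a1, a2⟩ := log_two_sided u1
  obtain ⟨b1, b2⟩ := log_two_sided v1
  have e : j / s ^ 2 = j * (1 - p) / s ^ 2 - j * (-p) / s ^ 2 := by ring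
  have e2 : 1.02 / s ^ 2 = 1.02 * (1 / s ^ 2) := by ring
  rw [e, e2, abs_le]
  constructor <;> linarith

lemma log_bound {M : ℕ} {p s : ℝ} (h0 : 0 < p) (h1 : p < 1) (hs : 100 ≤ s)
    (hsq : s ^ 2 = M * p * (1 - p)) {a c : ℕ} (ha : M * p - s < a)
    (hc : (c : ℝ) < M * p + s + 1) (k : ℕ) (hak : a ≤ k) (hkc : k ≤ c) :
    |log (gw M p k) - log (gw M p a) + (((k : ℝ) - M * p - 1 / 2) ^ 2
      - ((a : ℝ) - M * p - 1 / 2) ^ 2) / (2 * s ^ 2)| ≤ ((k : ℝ) - a) * (1.02 / s ^ 2) := by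
  have hs2 : 0 < s ^ 2 := by positivity
  induction k, hak using Nat.le_induction with
  | base => simp
  | succ k hk ih =>
    have ih := ih (by omega)
    have hk' : (a : ℝ) ≤ k := by exact_mod_cast hk
    have hkc' : (k : ℝ) + 1 ≤ c := by exact_mod_cast hkc
    obtain ⟨-, -, h⟩ := step_bound h0 h1 hs hsq (k := k) (by linarith) (by linarith)
    have := abs_add_le (log (gw M p k) - log (gw M p a) + (((k : ℝ) - M * p - 1 / 2) ^ 2
      - ((a : ℝ) - M * p - 1 / 2) ^ 2) / (2 * s ^ 2))
      (log (gw M p (k + 1)) - log (gw M p k) + ((k : ℝ) - M * p) / s ^ 2)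
    have e : log (gw M p k) - log (gw M p a) + (((k : ℝ) - M * p - 1 / 2) ^ 2
      - ((a : ℝ) - M * p - 1 / 2) ^ 2) / (2 * s ^ 2) +
      (log (gw M p (k + 1)) - log (gw M p k) + ((k : ℝ) - M * p) / s ^ 2) =
      log (gw M p (k + 1)) - log (gw M p a) + ((((k + 1 : ℕ) : ℝ) - M * p - 1 / 2) ^ 2
      - ((a : ℝ) - M * p - 1 / 2) ^ 2) / (2 * s ^ 2) := by
      push_cast; field_simp; ring
    rw [e] at this
    push_cast at this ⊢
    linarith

set_option maxHeartbeats 4000000 in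
lemma main_bound {M : ℕ} {p s : ℝ} (h0 : 0 < p) (h1 : p < 1) (hs : 100 ≤ s)
    (hsq : s ^ 2 = M * p * (1 - p)) {a c : ℕ} (ha : M * p - s < a) (ha' : a ≤ M * p - s + 1)
    (hc' : M * p + s ≤ c) (hc : (c : ℝ) < M * p + s + 1) :
    0 < ∑ k ∈ Finset.Ico a c, bw M p k ∧
    |∑ k ∈ Finset.Ico a c, ((k : ℝ) - M * p) * bw M p k| ≤ 3 * ∑ k ∈ Finset.Ico a c, bw M p k := by
  have hq : 0 < 1 - p := by linarith
  have hs2 : 0 < s ^ 2 := by positivity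
  have hac' : (a : ℝ) < c := by linarith
  have hac : a < c := by exact_mod_cast hac'
  have hk : ∀ k ∈ Finset.Ico a c, k < M ∧ 0 < k ∧ (k : ℝ) < M * p + s := by
    intro k hk
    rw [Finset.mem_Ico] at hk
    have h2 : (a : ℝ) ≤ k := by exact_mod_cast hk.1
    have h3 : (k : ℝ) + 1 ≤ c := by exact_mod_cast hk.2
    obtain ⟨x, y, -⟩ := step_bound h0 h1 hs hsq (k := k) (by linarith) (by linarith)
    exact ⟨x, y, by linarith⟩
  have hgpos : ∀ k ∈ Finset.Ico a c, 0 < gw M p k := by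
    intro k hk'
    obtain ⟨x, y, -⟩ := hk k hk'
    have := bw_pos h0 h1 x.le
    have : (0:ℝ) < k := by exact_mod_cast y
    unfold gw; positivity
  have hga := hgpos a (Finset.mem_Ico.mpr ⟨le_rfl, hac⟩)
  have hgc : 0 < gw M p c := by
    obtain ⟨x, y, -⟩ := hk (c - 1) (Finset.mem_Ico.mpr ⟨by omega, by omega⟩)
    have hcM : c ≤ M := by omega
    have := bw_pos h0 h1 hcM
    have : (0:ℝ) < c := by exact_mod_cast (by omega : 0 < c)
    unfold gw; positivity
  have hbd : ∀ k : ℕ, a ≤ k → k ≤ c → ((k : ℝ) - a) * (1.02 / s ^ 2) ≤ 2.1 / s := by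
    intro k _ hkc
    have h3 : (k : ℝ) ≤ c := by exact_mod_cast hkc
    rw [mul_div_assoc', div_le_div_iff₀ hs2 (by positivity)]
    have : ((k : ℝ) - a) * 1.02 ≤ 2.1 * s := by linarith
    nlinarith
  have hsqa : (s - 1/2) ^ 2 ≤ ((a : ℝ) - M * p - 1 / 2) ^ 2 ∧
      ((a : ℝ) - M * p - 1 / 2) ^ 2 ≤ (s + 1/2) ^ 2 := by
    constructor <;> nlinarith
  have hdiff : ∀ D : ℝ, D ≤ 2 * s → D / (2 * s ^ 2) ≤ 1 / s := by
    intro D hD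
    rw [div_le_div_iff₀ (by positivity) (by positivity)]
    nlinarith
  have e1 : (4 : ℝ) / s = 2.1 / s + 1 / s + 0.9 / s := by ring
  have p9 : 0 < 0.9 / s := by positivity
  -- lower bound for all k
  have hlow : ∀ k ∈ Finset.Ico a c, gw M p a * exp (-(4 / s)) ≤ gw M p k := by
    intro k hk'
    have hk2 := Finset.mem_Ico.mp hk'
    have h2 : (a : ℝ) ≤ k := by exact_mod_cast hk2.1
    obtain ⟨-, -, h4⟩ := hk k hk'
    have h := (abs_le.mp (log_bound h0 h1 hs hsq ha hc k hk2.1 hk2.2.le)).1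
    have h' := hbd k hk2.1 hk2.2.le
    have hD := hdiff (((k : ℝ) - M * p - 1 / 2) ^ 2 - ((a : ℝ) - M * p - 1 / 2) ^ 2) (by
      have : ((k : ℝ) - M * p - 1 / 2) ^ 2 ≤ (s + 1/2) ^ 2 := by
        apply sq_le_sq' <;> linarith
      nlinarith [hsqa.1])
    rw [← Real.exp_log hga, ← Real.exp_add, ← Real.exp_log (hgpos k hk')]
    apply Real.exp_le_exp.mpr
    linarith
  have hend : |log (gw M p c) - log (gw M p a)| ≤ 4 / s := by
    have h := abs_le.mp (log_bound h0 h1 hs hsq ha hc c hac.le le_rfl)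
    have h' := hbd c hac.le le_rfl
    have hc1 : ((c : ℝ) - M * p - 1 / 2) ^ 2 ≤ (s + 1/2) ^ 2 := by
        apply sq_le_sq' <;> linarith
    have hc2 : (s - 1/2) ^ 2 ≤ ((c : ℝ) - M * p - 1 / 2) ^ 2 := by
        apply sq_le_sq' <;> linarith
    have hD := hdiff (((c : ℝ) - M * p - 1 / 2) ^ 2 - ((a : ℝ) - M * p - 1 / 2) ^ 2) (by
      nlinarith [hsqa.1])
    have hD' := hdiff (-(((c : ℝ) - M * p - 1 / 2) ^ 2 - ((a : ℝ) - M * p - 1 / 2) ^ 2)) (by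
      nlinarith [hsqa.2])
    rw [neg_div] at hD'
    rw [abs_le]
    constructor <;> linarith [h.1, h.2]
  set x := 4 / s with hx
  have hx0 : 0 < x := by positivity
  have hx1 : x ≤ 1 / 25 := by rw [hx, div_le_div_iff₀ (by positivity) (by norm_num)]; linarith
  have hexp : exp x ≤ 1 + x + x ^ 2 := by
    have := Real.abs_exp_sub_one_sub_id_le (x := x) (by rw [abs_of_pos hx0]; linarith)
    linarith [(abs_le.mp this).2]
  have hexpn : 1 - x ≤ exp (-x) := by linarith [Real.add_one_le_exp (-x)]
  have hcg : |gw M p a - gw M p c| ≤ gw M p a * (x + x ^ 2) := by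
    have e : gw M p c = gw M p a * exp (log (gw M p c) - log (gw M p a)) := by
      rw [Real.exp_sub, Real.exp_log hga, Real.exp_log hgc]; field_simp
    obtain ⟨l, u⟩ := abs_le.mp hend
    have u' := Real.exp_le_exp.mpr u
    have l' := Real.exp_le_exp.mpr l
    rw [abs_le]
    constructor
    · rw [e]; nlinarith
    · rw [e]; nlinarith
  have htel : ∑ k ∈ Finset.Ico a c, ((k : ℝ) - M * p) * bw M p k = gw M p a - gw M p c := by
    rw [Finset.sum_congr rfl (fun k hk' => gw_sub (hk k hk').1)]
    have := Finset.sum_Ico_sub (gw M p) hac.le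
    have h2 : ∑ k ∈ Finset.Ico a c, (gw M p k - gw M p (k + 1)) =
      - ∑ k ∈ Finset.Ico a c, (gw M p (k + 1) - gw M p k) := by
      rw [← Finset.sum_neg_distrib]; apply Finset.sum_congr rfl; intros; ring
    rw [h2, this]; ring
  have hsum : (2 * s - 1) * (gw M p a * (1 - x) / (s ^ 2 + s)) ≤ ∑ k ∈ Finset.Ico a c, bw M p k := by
    have h : ∀ k ∈ Finset.Ico a c, gw M p a * (1 - x) / (s ^ 2 + s) ≤ bw M p k := by
      intro k hk'
      obtain ⟨hkM, h3, h4⟩ := hk k hk'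
      have hb := bw_pos h0 h1 hkM.le
      rw [div_le_iff₀ (by positivity)]
      have h5 : gw M p a * (1 - x) ≤ gw M p k :=
        (mul_le_mul_of_nonneg_left hexpn hga.le).trans (hlow k hk')
      have h6 : (k : ℝ) * (1 - p) ≤ s ^ 2 + s := by rw [hsq]; nlinarith
      have h7 : gw M p k ≤ (s ^ 2 + s) * bw M p k := by
        unfold gw; exact mul_le_mul_of_nonneg_right h6 hb.le
      linarith
    have h8 := Finset.card_nsmul_le_sum _ _ _ h
    rw [Nat.card_Ico, nsmul_eq_mul, Nat.cast_sub hac.le] at h8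
    refine le_trans ?_ h8
    apply mul_le_mul_of_nonneg_right (by linarith)
    have : 0 < 1 - x := by linarith
    positivity
  have hsumpos : 0 < ∑ k ∈ Finset.Ico a c, bw M p k := by
    refine lt_of_lt_of_le ?_ hsum
    have : 0 < 1 - x := by linarith
    have : 0 < 2 * s - 1 := by linarith
    positivity
  refine ⟨hsumpos, ?_⟩
  rw [htel]
  refine hcg.trans (le_trans ?_ (mul_le_mul_of_nonneg_left hsum (by norm_num)))
  have e : 3 * ((2 * s - 1) * (gw M p a * (1 - x) / (s ^ 2 + s))) =
    gw M p a * (3 * (2 * s - 1) * (1 - x) / (s ^ 2 + s)) := by ring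
  rw [e]
  apply mul_le_mul_of_nonneg_left _ hga.le
  rw [le_div_iff₀ (by positivity)]
  have hxs : x * s = 4 := by rw [hx]; field_simp
  have : (x + x ^ 2) * (s ^ 2 + s) = 4 * (1 + x) * (s + 1) := by
    linear_combination (1 + x) * (s + 1) * hxs
  rw [this]
  nlinarith

lemma rhs_ge : (3 : ℝ) ≤ 3 / ((Real.sqrt (2 * π))⁻¹ * ∫ x in (-1 : ℝ)..1, exp (-x ^ 2 / 2)) := by
  have hI : ∫ x in (-1 : ℝ)..1, exp (-x ^ 2 / 2) ≤ 2 := by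
    have := intervalIntegral.integral_mono_on (a := (-1:ℝ)) (b := 1) (μ := volume)
      (f := fun x => exp (-x ^ 2 / 2)) (g := fun _ => (1:ℝ)) (by norm_num)
      (Continuous.intervalIntegrable (by fun_prop) _ _) (by simp)
      (fun x _ => by
        rw [Real.exp_le_one_iff]; nlinarith [sq_nonneg x])
    refine this.trans ?_
    simp; norm_num
  have hI0 : 0 < ∫ x in (-1 : ℝ)..1, exp (-x ^ 2 / 2) :=
    intervalIntegral.intervalIntegral_pos_of_pos (Continuous.intervalIntegrable (by fun_prop) _ _)
      (fun x => Real.exp_pos _) (by norm_num)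
  have hs : 2 ≤ Real.sqrt (2 * π) := by
    apply Real.le_sqrt_of_sq_le
    nlinarith [Real.pi_gt_three]
  have hs0 : 0 < Real.sqrt (2 * π) := by linarith
  rw [le_div_iff₀ (by positivity)]
  have : (Real.sqrt (2 * π))⁻¹ * ∫ x in (-1 : ℝ)..1, exp (-x ^ 2 / 2) ≤ 1 := by
    rw [inv_mul_le_iff₀ hs0]; linarith
  linarith

/-- For `N` Binomial(M, p) with `M = n^{1+α}` and `I` the one-standard-deviation
interval around the mean `Mp`, the conditional mean shift satisfies, for `n` large,
`|Mp − E(N | N ∈ I)| ≤ 3 / ((2π)^{-1/2} ∫_{−1}^1 e^{−x²/2} dx)`. -/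
theorem stmt13
    {Ω : Type*} [MeasurableSpace Ω] (μ : Measure Ω) [IsProbabilityMeasure μ]
    (α p : ℝ) (hα : 0 < α) (hp : p ∈ Ioo (0 : ℝ) 1)
    (N : ℕ → Ω → ℕ) (hmeas : ∀ n, Measurable (N n))
    (hbinom : ∀ n k : ℕ,
      μ {ω | N n ω = k} =
        ENNReal.ofReal
          ((⌊(n : ℝ) ^ (1 + α)⌋₊.choose k : ℝ) * p ^ k *
            (1 - p) ^ (⌊(n : ℝ) ^ (1 + α)⌋₊ - k))) :
    ∃ n₀ : ℕ, ∀ n ≥ n₀,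
      |(⌊(n : ℝ) ^ (1 + α)⌋₊ : ℝ) * p -
          (∫ ω in {ω | (N n ω : ℝ) ∈
              Ioo ((⌊(n : ℝ) ^ (1 + α)⌋₊ : ℝ) * p -
                  Real.sqrt ((⌊(n : ℝ) ^ (1 + α)⌋₊ : ℝ) * p * (1 - p)))
                ((⌊(n : ℝ) ^ (1 + α)⌋₊ : ℝ) * p +
                  Real.sqrt ((⌊(n : ℝ) ^ (1 + α)⌋₊ : ℝ) * p * (1 - p)))},
              (N n ω : ℝ) ∂μ) /
            (μ {ω | (N n ω : ℝ) ∈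
              Ioo ((⌊(n : ℝ) ^ (1 + α)⌋₊ : ℝ) * p -
                  Real.sqrt ((⌊(n : ℝ) ^ (1 + α)⌋₊ : ℝ) * p * (1 - p)))
                ((⌊(n : ℝ) ^ (1 + α)⌋₊ : ℝ) * p +
                  Real.sqrt ((⌊(n : ℝ) ^ (1 + α)⌋₊ : ℝ) * p * (1 - p)))}).toReal| ≤
        3 / ((Real.sqrt (2 * π))⁻¹ * ∫ x in (-1 : ℝ)..1, exp (-x ^ 2 / 2)) := by
  obtain ⟨h0, h1⟩ := hp
  have hq : 0 < 1 - p := by linarith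
  have hlim : Filter.Tendsto (fun n : ℕ => (⌊(n : ℝ) ^ (1 + α)⌋₊ : ℝ)) Filter.atTop Filter.atTop :=
    tendsto_natCast_atTop_atTop.comp (tendsto_nat_floor_atTop.comp
      ((tendsto_rpow_atTop (by linarith : 0 < 1 + α)).comp tendsto_natCast_atTop_atTop))
  obtain ⟨n₀, hn₀⟩ := Filter.eventually_atTop.mp
    (hlim.eventually_ge_atTop (10000 / (p * (1 - p))))
  refine ⟨n₀, fun n hn => ?_⟩
  have hM := hn₀ n hn
  have hb := hbinom n
  have hN := hmeas n
  clear hbinom hlim hn₀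
  generalize ⌊(n : ℝ) ^ (1 + α)⌋₊ = M at *
  generalize N n = X at *
  rw [div_le_iff₀ (by positivity)] at hM
  have hsq : Real.sqrt (M * p * (1 - p)) ^ 2 = M * p * (1 - p) := Real.sq_sqrt (by positivity)
  have hs : 100 ≤ Real.sqrt (M * p * (1 - p)) := Real.le_sqrt_of_sq_le (by linarith)
  generalize Real.sqrt (M * p * (1 - p)) = s at *
  have hMp : s ^ 2 ≤ M * p := by rw [hsq]; nlinarith [mul_nonneg (Nat.cast_nonneg (α := ℝ) M) h0.le]
  have hlo : 0 ≤ M * p - s := by nlinarith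
  obtain ⟨a, haI⟩ : ∃ a, a = ⌊M * p - s⌋₊ + 1 := ⟨_, rfl⟩
  obtain ⟨c, hcI⟩ : ∃ c, c = ⌈M * p + s⌉₊ := ⟨_, rfl⟩
  have ha : M * p - s < a := by rw [haI]; push_cast; exact Nat.lt_floor_add_one _
  have ha' : (a : ℝ) ≤ M * p - s + 1 := by
    rw [haI]; push_cast; linarith [Nat.floor_le hlo]
  have hc' : M * p + s ≤ c := by rw [hcI]; exact Nat.le_ceil _
  have hc : (c : ℝ) < M * p + s + 1 := by rw [hcI]; exact Nat.ceil_lt_add_one (by linarith)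
  obtain ⟨hpos, hbound⟩ := main_bound h0 h1 hs hsq ha ha' hc' hc
  have hset : {ω | (X ω : ℝ) ∈ Ioo (M * p - s) (M * p + s)} =
      X ⁻¹' (↑(Finset.Ico a c) : Set ℕ) := by
    ext ω
    simp only [mem_setOf_eq, mem_preimage, Finset.coe_Ico, mem_Ioo, mem_Ico]
    constructor
    · rintro ⟨h2, h3⟩
      constructor
      · have : (a : ℝ) < X ω + 1 := by linarith
        have : a < X ω + 1 := by exact_mod_cast this
        omega
      · have : (X ω : ℝ) < c := by linarith
        exact_mod_cast this
    · rintro ⟨h2, h3⟩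
      have h2' : (a : ℝ) ≤ X ω := by exact_mod_cast h2
      have h3' : (X ω : ℝ) + 1 ≤ c := by exact_mod_cast h3
      exact ⟨by linarith, by linarith⟩
  have hsing : ∀ k, (μ.map X).real {k} = bw M p k := by
    intro k
    rw [measureReal_def, Measure.map_apply hN (measurableSet_singleton k)]
    have : X ⁻¹' {k} = {ω | X ω = k} := rfl
    rw [this, hb k, ENNReal.toReal_ofReal (by positivity)]
    rfl
  have : IsProbabilityMeasure (μ.map X) := Measure.isProbabilityMeasure_map hN.aemeasurable
  have hden : (μ (X ⁻¹' (↑(Finset.Ico a c) : Set ℕ))).toReal = ∑ k ∈ Finset.Ico a c, bw M p k := by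
    rw [← Measure.map_apply hN (Finset.measurableSet _), ← measureReal_def,
      ← sum_measureReal_singleton]
    exact Finset.sum_congr rfl fun k _ => hsing k
  have hnum : ∫ ω in X ⁻¹' (↑(Finset.Ico a c) : Set ℕ), (X ω : ℝ) ∂μ =
      ∑ k ∈ Finset.Ico a c, (k : ℝ) * bw M p k := by
    rw [← setIntegral_map (f := fun k : ℕ => (k : ℝ)) (Finset.measurableSet _)
      (by fun_prop) hN.aemeasurable, integral_finset]
    · exact Finset.sum_congr rfl fun k _ => by rw [hsing k, smul_eq_mul, mul_comm]
    · exact IntegrableOn.finset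
  rw [hset, hden, hnum]
  refine le_trans ?_ rhs_ge
  have e : (M : ℝ) * p - (∑ k ∈ Finset.Ico a c, (k : ℝ) * bw M p k) /
      (∑ k ∈ Finset.Ico a c, bw M p k) =
      -(∑ k ∈ Finset.Ico a c, ((k : ℝ) - M * p) * bw M p k) /
      (∑ k ∈ Finset.Ico a c, bw M p k) := by
    simp only [sub_mul, Finset.sum_sub_distrib, ← Finset.mul_sum]
    field_simp
    ring
  rw [e, abs_div, abs_neg, abs_of_pos hpos, div_le_iff₀ hpos]
  exact hbound
end

section
/- Let N be Binomial(M, p) with M = n^{1+α}, and I the interval of width one standard deviation on each side of the mean Mp. Then for n large enough, E(|N − Mp|^r | N ∈ I) ≥ (Mp(1−p))^{r/2} · (∫_{−1}^{1} |x|^r dΦ(x)) / (2 ∫_{−1}^{1} e^{−x²/2} dx), where Φ is the standard normal c.d.f. -/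
open MeasureTheory Real Set

lemma aux_int {Ω : Type*} [MeasurableSpace Ω] (μ : Measure Ω) [IsProbabilityMeasure μ]
    (p : ℝ) (hp : p ∈ Ioo (0 : ℝ) 1) (M : ℕ) (N : Ω → ℕ) (hmeas : Measurable N)
    (hbinom : ∀ k : ℕ, μ {ω | N ω = k} =
        ENNReal.ofReal ((M.choose k : ℝ) * p ^ k * (1 - p) ^ (M - k)))
    (f : ℕ → ℂ) (C : ℝ) (hf : ∀ k, ‖f k‖ ≤ C) :
    ∫ ω, f (N ω) ∂μ = ∑ k ∈ Finset.range (M + 1),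
      (((M.choose k : ℝ) * p ^ k * (1 - p) ^ (M - k) : ℝ) : ℂ) * f k := by
  have : IsProbabilityMeasure (μ.map N) := Measure.isProbabilityMeasure_map hmeas.aemeasurable
  have h1 : 0 ≤ p := hp.1.le
  have h2 : 0 ≤ 1 - p := sub_nonneg.2 hp.2.le
  have hreal : ∀ k, (μ.map N).real {k} = (M.choose k : ℝ) * p ^ k * (1 - p) ^ (M - k) := by
    intro k
    rw [Measure.real, Measure.map_apply hmeas (measurableSet_singleton k)]
    have : N ⁻¹' {k} = {ω | N ω = k} := rfl
    rw [this, hbinom, ENNReal.toReal_ofReal (by positivity)]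
  rw [← integral_map (f := f) hmeas.aemeasurable (by fun_prop), integral_countable']
  · rw [tsum_eq_sum (s := Finset.range (M + 1))]
    · refine Finset.sum_congr rfl fun k _ => ?_
      rw [hreal, Complex.real_smul]
    · intro k hk
      rw [hreal, Nat.choose_eq_zero_of_lt (by simpa using hk)]
      simp
  · exact Integrable.of_bound (by fun_prop) C (.of_forall hf)

lemma aux_char {Ω : Type*} [MeasurableSpace Ω] (μ : Measure Ω) [IsProbabilityMeasure μ]
    (p : ℝ) (hp : p ∈ Ioo (0 : ℝ) 1) (M : ℕ) (N : Ω → ℕ) (hmeas : Measurable N)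
    (hbinom : ∀ k : ℕ, μ {ω | N ω = k} =
        ENNReal.ofReal ((M.choose k : ℝ) * p ^ k * (1 - p) ^ (M - k))) (t a : ℝ) :
    charFun (μ.map (fun ω => a * ((N ω : ℝ) - M * p))) t =
      (p * Complex.exp (t * a * (1 - p) * Complex.I)
        + (1 - p) * Complex.exp (t * a * (- p) * Complex.I)) ^ M := by
  rw [charFun_apply_real, integral_map (by fun_prop) (by fun_prop)]
  rw [aux_int μ p hp M N hmeas hbinom
    (fun k => Complex.exp (t * ((a * ((k : ℝ) - M * p) : ℝ) : ℂ) * Complex.I)) 1, add_pow]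
  · refine Finset.sum_congr rfl fun k hk => ?_
    have hk' : k ≤ M := by simpa [Nat.lt_succ_iff] using hk
    rw [mul_pow, mul_pow, ← Complex.exp_nat_mul, ← Complex.exp_nat_mul]
    have : Complex.exp (t * ((a * ((k : ℝ) - M * p) : ℝ) : ℂ) * Complex.I)
      = Complex.exp (k * (t * a * (1 - p) * Complex.I)) *
        Complex.exp ((M - k : ℕ) * (t * a * (-p) * Complex.I)) := by
      rw [← Complex.exp_add, Nat.cast_sub hk']
      congr 1
      push_cast
      ring
    rw [this]
    push_cast
    ring
  · intro k
    rw [← Complex.ofReal_mul, Complex.norm_exp_ofReal_mul_I]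

open ProbabilityTheory Filter Topology in
lemma aux_clt {Ω : Type*} [MeasurableSpace Ω] (μ : Measure Ω) [IsProbabilityMeasure μ]
    (p : ℝ) (hp : p ∈ Ioo (0 : ℝ) 1) (M : ℕ → ℕ) (hM : Tendsto M atTop atTop)
    (N : ℕ → Ω → ℕ) (hmeas : ∀ n, Measurable (N n))
    (hbinom : ∀ n k : ℕ, μ {ω | N n ω = k} =
        ENNReal.ofReal (((M n).choose k : ℝ) * p ^ k * (1 - p) ^ (M n - k)))
    (g : BoundedContinuousFunction ℝ ℝ) :
    Tendsto (fun n => ∫ ω, g ((√(M n * p * (1 - p)))⁻¹ * ((N n ω : ℝ) - M n * p)) ∂μ) atTop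
      (𝓝 (∫ x, g x ∂(gaussianReal 0 1))) := by
  have h1 : 0 < p := hp.1
  have h2 : 0 < 1 - p := sub_pos.2 hp.2
  set s := √(p * (1 - p)) with hs
  have hs0 : 0 < s := by positivity
  have hs2 : s ^ 2 = p * (1 - p) := Real.sq_sqrt (by positivity)
  let P : Measure ℝ := ENNReal.ofReal p • Measure.dirac 1 + ENNReal.ofReal (1 - p) • Measure.dirac 0
  have hP : IsProbabilityMeasure P := ⟨by
    simp [P, ← ENNReal.ofReal_add h1.le h2.le]⟩
  have hPint : ∀ {E : Type} [NormedAddCommGroup E] [NormedSpace ℝ E] [CompleteSpace E] (f : ℝ → E),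
      ∫ x, f x ∂P = p • f 1 + (1 - p) • f 0 := by
    intro E _ _ _ f
    rw [integral_add_measure, integral_smul_measure, integral_smul_measure, integral_dirac,
      integral_dirac, ENNReal.toReal_ofReal h1.le, ENNReal.toReal_ofReal h2.le]
    · exact (integrable_dirac (by simp)).smul_measure (by simp)
    · exact (integrable_dirac (by simp)).smul_measure (by simp)
  let X : ℝ → ℝ := fun x => (x - p) / s
  have hX : Measurable X := by fun_prop
  have hX0 : P[X] = 0 := by
    rw [hPint]; simp only [X, smul_eq_mul]; field_simp; ring
  have hX1 : P[X ^ 2] = 1 := by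
    rw [hPint]; simp only [X, smul_eq_mul, Pi.pow_apply, div_pow, hs2]; field_simp; ring
  let Z : ℕ → Ω → ℝ := fun n ω => (√(M n * p * (1 - p)))⁻¹ * ((N n ω : ℝ) - M n * p)
  have hZ : ∀ n, Measurable (Z n) := fun n => by have := hmeas n; fun_prop
  have hpm : ∀ n, IsProbabilityMeasure (μ.map (Z n)) :=
    fun n => Measure.isProbabilityMeasure_map (hZ n).aemeasurable
  let ν : ℕ → ProbabilityMeasure ℝ := fun n => ⟨μ.map (Z n), hpm n⟩
  let γ : ProbabilityMeasure ℝ := ⟨gaussianReal 0 1, inferInstance⟩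
  have hconv : Tendsto ν atTop (𝓝 γ) := by
    refine ProbabilityMeasure.tendsto_iff_tendsto_charFun.2 fun t => ?_
    have key := (tendsto_charFun_inv_sqrt_mul_pow hX.aemeasurable hX0 hX1 t).comp hM
    have e1 : charFun (γ : Measure ℝ) t = Complex.exp (- t ^ 2 / 2) := by
      change charFun (gaussianReal 0 1) t = _
      simp [charFun_gaussianReal, neg_div]
    rw [e1]
    refine key.congr fun n => ?_
    change _ = charFun (μ.map (Z n)) t
    simp only [Z, Function.comp]
    rw [aux_char μ p hp (M n) (N n) (hmeas n) (hbinom n)]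
    rw [charFun_apply_real, integral_map hX.aemeasurable (by fun_prop), hPint]
    have : (√(M n * p * (1 - p)))⁻¹ = (√(M n))⁻¹ * s⁻¹ := by
      rw [mul_assoc, Real.sqrt_mul (by positivity), mul_inv]
    rw [this]
    simp only [X, Complex.real_smul]
    push_cast
    congr 4
    · congr 1; ring
    · simp; ring
  have := ProbabilityMeasure.tendsto_iff_forall_integral_tendsto.1 hconv g
  refine this.congr fun n => ?_
  change ∫ x, g x ∂(μ.map (Z n)) = _
  rw [integral_map (hZ n).aemeasurable (by fun_prop)]

lemma aux_K : 1 ≤ ∫ x in (-1 : ℝ)..1, exp (-x ^ 2 / 2) := by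
  have : ∫ x in (-1 : ℝ)..1, (1 - x ^ 2 / 2) ≤ ∫ x in (-1 : ℝ)..1, exp (-x ^ 2 / 2) := by
    refine intervalIntegral.integral_mono_on (by norm_num)
      (Continuous.intervalIntegrable (by fun_prop) _ _)
      (Continuous.intervalIntegrable (by fun_prop) _ _) fun x _ => ?_
    have := Real.add_one_le_exp (-x ^ 2 / 2)
    linarith
  refine le_trans ?_ this
  rw [intervalIntegral.integral_sub (by simp) (Continuous.intervalIntegrable (by fun_prop) _ _)]
  simp
  norm_num

lemma aux_J (r : ℝ) (hr : 1 ≤ r) :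
    0 < ∫ x in (-1 : ℝ)..1, |x| ^ r * ((Real.sqrt (2 * π))⁻¹ * exp (-x ^ 2 / 2)) := by
  have hc : Continuous fun x : ℝ => |x| ^ r * ((Real.sqrt (2 * π))⁻¹ * exp (-x ^ 2 / 2)) := by
    refine Continuous.mul (continuous_abs.rpow_const fun x => Or.inr (by linarith)) (by fun_prop)
  refine intervalIntegral.integral_pos (by norm_num) hc.continuousOn (fun x _ => by positivity)
    ⟨1, by simp, by simp; positivity⟩

noncomputable def gk (r : ℝ) (k : ℕ) (x : ℝ) : ℝ := |min 1 (max (-1) x)| ^ r * min 1 (k * max 0 (1 - |x|))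

lemma gk_cont (r : ℝ) (hr : 1 ≤ r) (k : ℕ) : Continuous (gk r k) := by
  unfold gk
  refine Continuous.mul (Continuous.rpow_const (by fun_prop) fun x => Or.inr (by linarith))
    (by fun_prop)

lemma gk_nonneg (r : ℝ) (k : ℕ) (x : ℝ) : 0 ≤ gk r k x := by
  unfold gk
  have : 0 ≤ min (1 : ℝ) (k * max 0 (1 - |x|)) := le_min zero_le_one (by positivity)
  positivity

lemma gk_le (r : ℝ) (hr : 1 ≤ r) (k : ℕ) (x : ℝ) :
    gk r k x ≤ (Ioo (-1 : ℝ) 1).indicator (fun x => |x| ^ r) x := by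
  by_cases hx : x ∈ Ioo (-1 : ℝ) 1
  · rw [indicator_of_mem hx]
    unfold gk
    rw [max_eq_right hx.1.le, min_eq_right hx.2.le]
    exact mul_le_of_le_one_right (by positivity) (min_le_left _ _)
  · rw [indicator_of_notMem hx]
    have : 1 ≤ |x| := by
      by_contra h
      exact hx (abs_lt.1 (not_le.1 h))
    unfold gk
    rw [max_eq_left (by linarith : 1 - |x| ≤ 0)]
    simp

lemma gk_le_one (r : ℝ) (hr : 1 ≤ r) (k : ℕ) (x : ℝ) : gk r k x ≤ 1 := by
  refine (gk_le r hr k x).trans ?_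
  refine indicator_le' (fun x hx => ?_) (fun _ _ => zero_le_one) x
  exact Real.rpow_le_one (abs_nonneg _) (abs_lt.2 hx).le (by linarith)

open ProbabilityTheory Filter Topology in
lemma gk_exists (r : ℝ) (hr : 1 ≤ r) : ∃ k,
    (∫ x in (-1 : ℝ)..1, |x| ^ r * ((Real.sqrt (2 * π))⁻¹ * exp (-x ^ 2 / 2))) / 2 <
      ∫ x, gk r k x ∂(gaussianReal 0 1) := by
  have hJ := aux_J r hr
  have hlim : Tendsto (fun k => ∫ x, gk r k x ∂(gaussianReal 0 1)) atTop
      (𝓝 (∫ x, (Ioo (-1 : ℝ) 1).indicator (fun x => |x| ^ r) x ∂(gaussianReal 0 1))) := by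
    refine tendsto_integral_of_dominated_convergence (fun _ => 1)
      (fun k => (gk_cont r hr k).aestronglyMeasurable) (by simp) (fun k => .of_forall fun x => ?_)
      (.of_forall fun x => ?_)
    · rw [Real.norm_of_nonneg (gk_nonneg r k x)]
      exact gk_le_one r hr k x
    · by_cases hx : x ∈ Ioo (-1 : ℝ) 1
      · rw [indicator_of_mem hx]
        have hpos : 0 < 1 - |x| := sub_pos.2 (abs_lt.2 hx)
        refine tendsto_const_nhds.congr' ?_
        have : Tendsto (fun k : ℕ => (k : ℝ) * (1 - |x|)) atTop atTop :=
          tendsto_natCast_atTop_atTop.atTop_mul_const hpos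
        filter_upwards [this.eventually_ge_atTop 1] with k hk
        unfold gk
        rw [max_eq_right hpos.le, min_eq_left hk, max_eq_right hx.1.le, min_eq_right hx.2.le, mul_one]
      · refine tendsto_const_nhds.congr fun k => le_antisymm ?_ ?_
        · rw [indicator_of_notMem hx]; exact gk_nonneg r k x
        · exact gk_le r hr k x
  have heq : (∫ x, (Ioo (-1 : ℝ) 1).indicator (fun x => |x| ^ r) x ∂(gaussianReal 0 1)) =
      ∫ x in (-1 : ℝ)..1, |x| ^ r * ((Real.sqrt (2 * π))⁻¹ * exp (-x ^ 2 / 2)) := by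
    rw [integral_gaussianReal_eq_integral_smul (by simp), intervalIntegral.integral_of_le (by norm_num),
      integral_Ioc_eq_integral_Ioo, ← integral_indicator measurableSet_Ioo]
    congr 1
    ext x
    by_cases hx : x ∈ Ioo (-1 : ℝ) 1
    · simp only [indicator_of_mem hx, gaussianPDFReal, smul_eq_mul]
      simp
      ring
    · simp only [indicator_of_notMem hx, smul_zero]
  rw [heq] at hlim
  exact (hlim.eventually_const_lt (half_lt_self hJ)).exists

open ProbabilityTheory Filter Topology in
theorem stmt14
    {Ω : Type*} [MeasurableSpace Ω] (μ : Measure Ω) [IsProbabilityMeasure μ]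
    (α p r : ℝ) (hα : 0 < α) (hp : p ∈ Ioo (0 : ℝ) 1) (hr : 1 ≤ r)
    (N : ℕ → Ω → ℕ) (hmeas : ∀ n, Measurable (N n))
    (hbinom : ∀ n k : ℕ,
      μ {ω | N n ω = k} =
        ENNReal.ofReal
          ((⌊(n : ℝ) ^ (1 + α)⌋₊.choose k : ℝ) * p ^ k *
            (1 - p) ^ (⌊(n : ℝ) ^ (1 + α)⌋₊ - k))) :
    ∃ n₀ : ℕ, ∀ n ≥ n₀,
      (∫ ω in {ω | (N n ω : ℝ) ∈
            Ioo ((⌊(n : ℝ) ^ (1 + α)⌋₊ : ℝ) * p -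
                Real.sqrt ((⌊(n : ℝ) ^ (1 + α)⌋₊ : ℝ) * p * (1 - p)))
              ((⌊(n : ℝ) ^ (1 + α)⌋₊ : ℝ) * p +
                Real.sqrt ((⌊(n : ℝ) ^ (1 + α)⌋₊ : ℝ) * p * (1 - p)))},
          |(N n ω : ℝ) - (⌊(n : ℝ) ^ (1 + α)⌋₊ : ℝ) * p| ^ r ∂μ) /
          (μ {ω | (N n ω : ℝ) ∈
            Ioo ((⌊(n : ℝ) ^ (1 + α)⌋₊ : ℝ) * p -
                Real.sqrt ((⌊(n : ℝ) ^ (1 + α)⌋₊ : ℝ) * p * (1 - p)))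
              ((⌊(n : ℝ) ^ (1 + α)⌋₊ : ℝ) * p +
                Real.sqrt ((⌊(n : ℝ) ^ (1 + α)⌋₊ : ℝ) * p * (1 - p)))}).toReal ≥
        ((⌊(n : ℝ) ^ (1 + α)⌋₊ : ℝ) * p * (1 - p)) ^ (r / 2) *
          (∫ x in (-1 : ℝ)..1, |x| ^ r * ((Real.sqrt (2 * π))⁻¹ * exp (-x ^ 2 / 2))) /
          (2 * ∫ x in (-1 : ℝ)..1, exp (-x ^ 2 / 2)) := by
  obtain ⟨k, hk⟩ := gk_exists r hr
  have hJ := aux_J r hr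
  have hK := aux_K
  set J := ∫ x in (-1 : ℝ)..1, |x| ^ r * ((Real.sqrt (2 * π))⁻¹ * exp (-x ^ 2 / 2))
  set K := ∫ x in (-1 : ℝ)..1, exp (-x ^ 2 / 2)
  have hM : Tendsto (fun n : ℕ => ⌊(n : ℝ) ^ (1 + α)⌋₊) atTop atTop :=
    tendsto_nat_floor_atTop.comp ((tendsto_rpow_atTop (by linarith)).comp tendsto_natCast_atTop_atTop)
  let g : BoundedContinuousFunction ℝ ℝ := BoundedContinuousFunction.ofNormedAddCommGroup (gk r k)
    (gk_cont r hr k) 1 (fun x => by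
      rw [Real.norm_of_nonneg (gk_nonneg r k x)]; exact gk_le_one r hr k x)
  have hclt := aux_clt μ p hp _ hM N hmeas hbinom g
  have hev := (hclt.eventually_const_lt hk).and (hM.eventually_ge_atTop 1)
  obtain ⟨n₀, hn₀⟩ := eventually_atTop.1 hev
  refine ⟨n₀, fun n hn => ?_⟩
  obtain ⟨hint, hM1⟩ := hn₀ n hn
  beta_reduce at hint hM1
  generalize ⌊(n : ℝ) ^ (1 + α)⌋₊ = M at hint hM1 ⊢
  have hm := hmeas n
  have h1 : 0 < p := hp.1
  have h2 : 0 < 1 - p := sub_pos.2 hp.2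
  have hMr : (0 : ℝ) < M := by exact_mod_cast hM1
  have hV : 0 < (M : ℝ) * p * (1 - p) := by positivity
  have hsr : ((M : ℝ) * p * (1 - p)) ^ (r / 2) = √((M : ℝ) * p * (1 - p)) ^ r := by
    rw [Real.sqrt_eq_rpow, ← Real.rpow_mul hV.le]; congr 1; ring
  rw [hsr]
  set s := √((M : ℝ) * p * (1 - p))
  have hs : 0 < s := Real.sqrt_pos.2 hV
  set A := {ω | (N n ω : ℝ) ∈ Ioo ((M : ℝ) * p - s) ((M : ℝ) * p + s)} with hA
  have hAm : MeasurableSet A := by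
    have : Measurable fun ω => (N n ω : ℝ) := by fun_prop
    exact this measurableSet_Ioo
  have hsrpos : 0 < s ^ r := by positivity
  have hlow : s ^ r * (J / 2) < ∫ ω in A, |(N n ω : ℝ) - M * p| ^ r ∂μ := by
    refine (mul_lt_mul_of_pos_left hint hsrpos).trans_le ?_
    rw [← integral_const_mul, ← integral_indicator hAm]
    refine integral_mono_of_nonneg (.of_forall fun ω => ?_) ?_ (.of_forall fun ω => ?_)
    · exact mul_nonneg hsrpos.le (gk_nonneg _ _ _)
    · refine Integrable.of_bound (C := s ^ r) ?_ (.of_forall fun ω => ?_)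
      · refine (Measurable.indicator ?_ hAm).aestronglyMeasurable
        fun_prop
      · by_cases hω : ω ∈ A
        · rw [indicator_of_mem hω, Real.norm_of_nonneg (by positivity)]
          refine Real.rpow_le_rpow (abs_nonneg _) (abs_le.2 ?_) (by linarith)
          obtain ⟨ha, hb⟩ := hω
          constructor <;> linarith
        · rw [indicator_of_notMem hω]; simpa using hsrpos.le
    · have hle := gk_le r hr k (s⁻¹ * ((N n ω : ℝ) - M * p))
      refine (mul_le_mul_of_nonneg_left hle hsrpos.le).trans ?_
      by_cases hω : ω ∈ A
      · rw [indicator_of_mem hω]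
        refine (mul_le_mul_of_nonneg_left
          (indicator_le_self' (fun _ _ => by positivity) _) hsrpos.le).trans ?_
        rw [← Real.mul_rpow hs.le (abs_nonneg _), abs_mul, abs_of_pos (inv_pos.2 hs),
          mul_inv_cancel_left₀ hs.ne']
      · rw [indicator_of_notMem hω, indicator_of_notMem, mul_zero]
        intro h
        apply hω
        obtain ⟨ha, hb⟩ := h
        rw [inv_mul_eq_div] at ha hb
        rw [lt_div_iff₀ hs] at ha
        rw [div_lt_iff₀ hs] at hb
        exact ⟨by linarith, by linarith⟩
  have hApos : 0 < (μ A).toReal := by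
    refine lt_of_le_of_ne ENNReal.toReal_nonneg fun h => ?_
    have h0 : μ A = 0 := by
      rcases (ENNReal.toReal_eq_zero_iff _).1 h.symm with h | h
      · exact h
      · exact absurd h (measure_ne_top _ _)
    rw [Measure.restrict_eq_zero.2 h0, integral_zero_measure] at hlow
    have : 0 < s ^ r * (J / 2) := by positivity
    linarith
  have hA1 : (μ A).toReal ≤ 1 := ENNReal.toReal_le_of_le_ofReal zero_le_one (by simpa using prob_le_one)
  rw [ge_iff_le, le_div_iff₀ hApos]
  have hJs : 0 < s ^ r * J := by positivity
  calc s ^ r * J / (2 * K) * (μ A).toReal ≤ s ^ r * J / (2 * K) * 1 := by gcongr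
    _ ≤ s ^ r * J / (2 * 1) * 1 := by gcongr
    _ = s ^ r * (J / 2) := by ring
    _ ≤ _ := hlow.le
end

section
/- Let N be Binomial(M, p) with M = n^{1+α}, and I the one-standard-deviation interval around Mp. There exists a constant c(r,p) > 0, independent of n, such that for n large enough the conditional r-th central moment satisfies M_r(N | N ∈ I) ≥ c(r,p) · n^{r(1+α)/2}. -/
open MeasureTheory Real Set

lemma aux_card (L U s a : ℝ) (hL : 0 ≤ L) (hs : 4 ≤ s) (hU : U = L + 2 * s) :
    ((Finset.Ioo ⌊L⌋₊ ⌈U⌉₊).card : ℝ) / 4 ≤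
      ((Finset.Ioo ⌊L⌋₊ ⌈U⌉₊).filter (fun k : ℕ => s / 2 ≤ |(k : ℝ) - a|)).card := by
  set F := Finset.Ioo ⌊L⌋₊ ⌈U⌉₊ with hF
  have h1 := Finset.card_filter_add_card_filter_not (s := F) (fun k : ℕ => s / 2 ≤ |(k : ℝ) - a|)
  have h2 : (F.filter (fun k : ℕ => ¬ s / 2 ≤ |(k : ℝ) - a|)).card ≤
      (Finset.Ioo ⌊a - s / 2⌋ ⌈a + s / 2⌉).card := by
    apply Finset.card_le_card_of_injOn (fun k : ℕ => (k : ℤ))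
    · intro k hk
      simp only [Finset.coe_filter, Set.mem_ofPred_eq, not_le, abs_lt] at hk
      simp only [Finset.coe_Ioo, Set.mem_Ioo, Int.floor_lt, Int.lt_ceil]
      push_cast
      constructor <;> linarith [hk.2.1, hk.2.2]
    · intro x _ y _ h
      simpa using h
  have h3 : ((Finset.Ioo ⌊a - s / 2⌋ ⌈a + s / 2⌉).card : ℝ) ≤ s + 1 := by
    rw [Int.card_Ioo]
    have hlt : ⌊a - s / 2⌋ < ⌈a + s / 2⌉ := by
      rw [Int.lt_ceil]
      linarith [Int.floor_le (a - s / 2)]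
    have : (((⌈a + s / 2⌉ - ⌊a - s / 2⌋ - 1).toNat : ℤ) : ℝ) ≤ s + 1 := by
      rw [Int.toNat_of_nonneg (by omega)]
      push_cast
      linarith [Int.ceil_lt_add_one (a + s / 2), Int.lt_floor_add_one (a - s / 2)]
    exact_mod_cast this
  have h4 : 2 * s - 1 ≤ (F.card : ℝ) := by
    rw [hF, Nat.card_Ioo]
    have hlt : ⌊L⌋₊ < ⌈U⌉₊ := by
      rw [Nat.lt_ceil]
      linarith [Nat.floor_le hL]
    rw [Nat.cast_sub (by omega), Nat.cast_sub hlt.le]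
    push_cast
    linarith [Nat.floor_le hL, Nat.le_ceil U]
  have h1' : ((F.filter (fun k : ℕ => s / 2 ≤ |(k : ℝ) - a|)).card : ℝ) +
    (F.filter (fun k : ℕ => ¬ s / 2 ≤ |(k : ℝ) - a|)).card = F.card := by exact_mod_cast h1
  have h2' : ((F.filter (fun k : ℕ => ¬ s / 2 ≤ |(k : ℝ) - a|)).card : ℝ) ≤ s + 1 :=
    le_trans (by exact_mod_cast h2) h3
  linarith

lemma aux_measure {Ω : Type*} [MeasurableSpace Ω] (μ : Measure Ω) [IsProbabilityMeasure μ]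
    (X : Ω → ℕ) (hX : Measurable X) (L U s a r K : ℝ) (hL : 0 ≤ L) (hs : 4 ≤ s)
    (hU : U = L + 2 * s) (hr : 1 ≤ r) (hK : 0 < K)
    (hpos : ∀ k : ℕ, (k : ℝ) ∈ Ioo L U → 0 < μ.real {ω | X ω = k})
    (hratio : ∀ k l : ℕ, (k : ℝ) ∈ Ioo L U → (l : ℝ) ∈ Ioo L U →
      μ.real {ω | X ω = k} ≤ K * μ.real {ω | X ω = l}) :
    (s / 2) ^ r / (4 * K ^ 2) ≤
      (∫ ω in {ω | (X ω : ℝ) ∈ Ioo L U}, |(X ω : ℝ) - a| ^ r ∂μ) /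
        (μ {ω | (X ω : ℝ) ∈ Ioo L U}).toReal := by
  set F := Finset.Ioo ⌊L⌋₊ ⌈U⌉₊ with hF
  set G := F.filter (fun k : ℕ => s / 2 ≤ |(k : ℝ) - a|) with hG
  have hmemF : ∀ k : ℕ, k ∈ F ↔ (k : ℝ) ∈ Ioo L U := by
    intro k
    rw [hF, Finset.mem_Ioo, Nat.floor_lt hL, Nat.lt_ceil, Set.mem_Ioo]
  have hcard := aux_card L U s a hL hs hU
  rw [← hF, ← hG] at hcard
  have hsum : ∀ H : Finset ℕ, μ.real {ω | X ω ∈ H} = ∑ k ∈ H, μ.real {ω | X ω = k} := by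
    intro H
    have : {ω | X ω ∈ H} = ⋃ k ∈ H, {ω | X ω = k} := by ext; simp
    rw [this, measureReal_biUnion_finset]
    · intro i _ j _ hij
      apply Set.disjoint_left.2
      intro ω h1 h2
      exact hij (h1.symm.trans h2)
    · intro k _
      exact hX (measurableSet_singleton k)
  have hI : {ω | (X ω : ℝ) ∈ Ioo L U} = {ω | X ω ∈ F} := by
    ext ω; exact (hmemF _).symm
  have hmF : ∀ H : Finset ℕ, MeasurableSet {ω | X ω ∈ H} := fun H =>
    hX (H.measurableSet)
  rw [hI]
  change _ ≤ _ / μ.real {ω | X ω ∈ F}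
  obtain ⟨k0, hk0⟩ : F.Nonempty := by
    have hlt : ⌊L⌋₊ + 1 < ⌈U⌉₊ := by
      rw [Nat.lt_ceil]
      push_cast
      linarith [Nat.floor_le hL]
    exact ⟨⌊L⌋₊ + 1, Finset.mem_Ioo.2 ⟨by omega, hlt⟩⟩
  have hk0' := (hmemF _).1 hk0
  have hw0 := hpos k0 hk0'
  set w0 := μ.real {ω | X ω = k0} with hw0def
  have hFle : μ.real {ω | X ω ∈ F} ≤ F.card * (K * w0) := by
    rw [hsum, ← nsmul_eq_mul]
    exact Finset.sum_le_card_nsmul _ _ _ fun k hk => hratio k k0 ((hmemF _).1 hk) hk0'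
  have hGge : G.card * (w0 / K) ≤ μ.real {ω | X ω ∈ G} := by
    rw [hsum, ← nsmul_eq_mul]
    refine Finset.card_nsmul_le_sum _ _ _ fun k hk => ?_
    rw [div_le_iff₀ hK, mul_comm]
    exact hratio k0 k hk0' ((hmemF _).1 (Finset.filter_subset _ _ hk))
  have hFpos : 0 < μ.real {ω | X ω ∈ F} := by
    rw [hsum]
    exact Finset.sum_pos (fun k hk => hpos k ((hmemF _).1 hk)) ⟨k0, hk0⟩
  have hFG : μ.real {ω | X ω ∈ F} / (4 * K ^ 2) ≤ μ.real {ω | X ω ∈ G} := by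
    refine le_trans ?_ hGge
    rw [div_le_iff₀ (by positivity)]
    refine hFle.trans ?_
    have : (G.card : ℝ) * (w0 / K) * (4 * K ^ 2) = (4 * G.card) * (K * w0) := by
      field_simp
    rw [this]
    apply mul_le_mul_of_nonneg_right _ (by positivity)
    linarith
  have hint : IntegrableOn (fun ω => |(X ω : ℝ) - a| ^ r) {ω | X ω ∈ F} μ := by
    apply Measure.integrableOn_of_bounded (M := (U + |a|) ^ r) (measure_ne_top _ _)
    · have hm : Measurable (fun k : ℕ => |(k : ℝ) - a| ^ r) := measurable_from_top
      exact (hm.comp hX).aestronglyMeasurable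
    · filter_upwards [ae_restrict_mem (hmF F)] with ω hω
      have h := (hmemF _).1 hω
      rw [Real.norm_of_nonneg (by positivity)]
      apply Real.rpow_le_rpow (abs_nonneg _) _ (by linarith)
      refine (abs_sub _ _).trans ?_
      rw [abs_of_nonneg (by positivity : (0:ℝ) ≤ X ω)]
      linarith [h.2]
  have hGF : {ω | X ω ∈ G} ⊆ {ω | X ω ∈ F} := by
    intro ω h
    have h' : X ω ∈ G := h
    rw [hG, Finset.mem_filter] at h'
    exact h'.1
  have h1 : ∫ ω in {ω | X ω ∈ G}, |(X ω : ℝ) - a| ^ r ∂μ ≤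
      ∫ ω in {ω | X ω ∈ F}, |(X ω : ℝ) - a| ^ r ∂μ := by
    apply setIntegral_mono_set hint
    · exact Filter.Eventually.of_forall fun ω => by positivity
    · exact Filter.Eventually.of_forall hGF
  have h2 : (s / 2) ^ r * μ.real {ω | X ω ∈ G} ≤
      ∫ ω in {ω | X ω ∈ G}, |(X ω : ℝ) - a| ^ r ∂μ := by
    apply setIntegral_ge_of_const_le_real (hmF G) (measure_ne_top _ _) _ (hint.mono_set hGF)
    intro ω hω
    have h' : X ω ∈ G := hω
    rw [hG, Finset.mem_filter] at h'
    exact Real.rpow_le_rpow (by linarith) h'.2 (by linarith)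
  rw [le_div_iff₀ hFpos]
  calc (s / 2) ^ r / (4 * K ^ 2) * μ.real {ω | X ω ∈ F}
      = (s / 2) ^ r * (μ.real {ω | X ω ∈ F} / (4 * K ^ 2)) := by ring
    _ ≤ (s / 2) ^ r * μ.real {ω | X ω ∈ G} :=
      mul_le_mul_of_nonneg_left hFG (by positivity)
    _ ≤ _ := h2.trans h1

/-- one-step ratio bounds and chaining -/
lemma aux_chain (w : ℕ → ℝ) (L U s : ℝ) (hs : 4 ≤ s) (hU : U = L + 2 * s)
    (hpos : ∀ k : ℕ, (k : ℝ) ∈ Ioo L U → 0 < w k)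
    (hstep : ∀ k : ℕ, (k : ℝ) ∈ Ioo L U → ((k + 1 : ℕ) : ℝ) ∈ Ioo L U →
      w (k + 1) ≤ exp (4 / s) * w k ∧ w k ≤ exp (4 / s) * w (k + 1)) (k l : ℕ)
    (hk : (k : ℝ) ∈ Ioo L U) (hl : (l : ℝ) ∈ Ioo L U) : w k ≤ exp 8 * w l := by
  have key : ∀ d k : ℕ, (k : ℝ) ∈ Ioo L U → ((k + d : ℕ) : ℝ) ∈ Ioo L U →
      w (k + d) ≤ exp (d * (4 / s)) * w k ∧ w k ≤ exp (d * (4 / s)) * w (k + d) := by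
    intro d
    induction d with
    | zero => intro k _ _; simp
    | succ d ih =>
      intro k hk hd
      have hmid : ((k + d : ℕ) : ℝ) ∈ Ioo L U := by
        simp only [Set.mem_Ioo] at *
        push_cast at *
        have : (0:ℝ) ≤ d := by positivity
        constructor <;> linarith
      obtain ⟨a1, a2⟩ := ih k hk hmid
      obtain ⟨b1, b2⟩ := hstep (k + d) hmid hd
      have e : exp (((d + 1 : ℕ) : ℝ) * (4 / s)) = exp (4 / s) * exp (d * (4 / s)) := by
        rw [← Real.exp_add]; push_cast; ring_nf
      rw [e]
      constructor
      · calc _ ≤ _ := b1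
          _ ≤ exp (4 / s) * (exp (d * (4 / s)) * w k) := by gcongr
          _ = _ := by ring
      · calc _ ≤ _ := a2
          _ ≤ exp (d * (4 / s)) * (exp (4 / s) * w (k + d + 1)) := by gcongr
          _ = _ := by rw [add_assoc]; ring
  have bd : ∀ d k : ℕ, (k : ℝ) ∈ Ioo L U → ((k + d : ℕ) : ℝ) ∈ Ioo L U →
      exp (d * (4 / s)) ≤ exp 8 := by
    intro d k hk hd
    apply Real.exp_le_exp.2
    have : (d : ℝ) ≤ 2 * s := by
      have := hk.1
      have := hd.2
      push_cast at this
      linarith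
    calc (d : ℝ) * (4 / s) ≤ 2 * s * (4 / s) := by gcongr
      _ = 8 := by field_simp; norm_num
  rcases le_total k l with h | h
  · obtain ⟨d, rfl⟩ := Nat.exists_eq_add_of_le h
    exact (key d k hk hl).2.trans (mul_le_mul_of_nonneg_right (bd d k hk hl) (hpos _ hl).le)
  · obtain ⟨d, rfl⟩ := Nat.exists_eq_add_of_le h
    exact (key d l hl hk).1.trans (mul_le_mul_of_nonneg_right (bd d l hl hk) (hpos _ hl).le)

lemma aux_step (M k : ℕ) (p s : ℝ) (hp : p ∈ Ioo (0 : ℝ) 1) (hs : 4 ≤ s)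
    (hs2 : s ^ 2 = M * p * (1 - p)) (hk1 : M * p - s < k) (hk2 : k < M * p + s)
    (hkM : k + 1 ≤ M) :
    ((M.choose (k + 1) : ℝ) * p ^ (k + 1) * (1 - p) ^ (M - (k + 1)) ≤
      exp (4 / s) * ((M.choose k : ℝ) * p ^ k * (1 - p) ^ (M - k))) ∧
    ((M.choose k : ℝ) * p ^ k * (1 - p) ^ (M - k) ≤
      exp (4 / s) * ((M.choose (k + 1) : ℝ) * p ^ (k + 1) * (1 - p) ^ (M - (k + 1)))) := by
  obtain ⟨hp0, hp1⟩ := hp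
  set A := (M.choose k : ℝ) * p ^ k * (1 - p) ^ (M - k) with hA
  set B := (M.choose (k + 1) : ℝ) * p ^ (k + 1) * (1 - p) ^ (M - (k + 1)) with hB
  have hq : 0 < 1 - p := by linarith
  have hA0 : 0 ≤ A := by positivity
  have hB0 : 0 ≤ B := by positivity
  have hrel : B * ((k + 1) * (1 - p)) = A * ((M - k) * p) := by
    have h := Nat.choose_succ_right_eq M k
    have h' : (M.choose (k + 1) : ℝ) * (k + 1) = M.choose k * (M - k) := by
      have : ((M.choose (k + 1) * (k + 1) : ℕ) : ℝ) = ((M.choose k * (M - k) : ℕ) : ℝ) := by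
        rw [h]
      push_cast [Nat.cast_sub (by omega : k ≤ M)] at this
      exact this
    have e : M - k = (M - (k + 1)) + 1 := by omega
    rw [hA, hB, e, pow_succ, pow_succ]
    calc _ = (M.choose (k + 1) : ℝ) * (k + 1) * (p ^ k * p * (1 - p) ^ (M - (k + 1)) * (1 - p)) := by
          ring
      _ = _ := by rw [h']; ring
  have hkR : (k : ℝ) + 1 ≤ M := by exact_mod_cast hkM
  have hE : 1 + 4 / s ≤ exp (4 / s) := by linarith [Real.add_one_le_exp (4 / s)]
  obtain ⟨x, hx⟩ : ∃ x : ℝ, (k : ℝ) = M * p + x := ⟨k - M * p, by ring⟩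
  have hxl : -s < x := by linarith
  have hxu : x < s := by linarith
  have hP : (M - k) * p = s ^ 2 - x * p := by rw [hx, hs2]; ring
  have hQ : ((k : ℝ) + 1) * (1 - p) = s ^ 2 + (x + 1) * (1 - p) := by rw [hx, hs2]; ring
  rw [hP, hQ] at hrel
  have hxp1 : x * p ≤ s := by nlinarith
  have hxp2 : -s ≤ x * p := by nlinarith
  have hxq1 : x * (1 - p) ≤ s := by nlinarith
  have hxq2 : -s ≤ x * (1 - p) := by nlinarith
  have hPpos : 0 < s ^ 2 - x * p := by nlinarith
  have hQpos : 0 < s ^ 2 + (x + 1) * (1 - p) := by nlinarith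
  have hs0 : 0 < s := by linarith
  constructor
  · refine le_trans ?_ (mul_le_mul_of_nonneg_right hE hA0)
    have : s ^ 2 - x * p ≤ (1 + 4 / s) * (s ^ 2 + (x + 1) * (1 - p)) := by
      have h : 4 / s * (s ^ 2 + (x + 1) * (1 - p)) ≥ 4 / s * (s ^ 2 - s) := by
        gcongr; nlinarith
      have h' : 4 / s * (s ^ 2 - s) = 4 * s - 4 := by field_simp
      rw [add_mul, one_mul]
      linarith
    refine le_of_mul_le_mul_right ?_ hQpos
    rw [hrel]
    calc _ ≤ A * ((1 + 4 / s) * (s ^ 2 + (x + 1) * (1 - p))) := by gcongr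
      _ = _ := by ring
  · refine le_trans ?_ (mul_le_mul_of_nonneg_right hE hB0)
    have : s ^ 2 + (x + 1) * (1 - p) ≤ (1 + 4 / s) * (s ^ 2 - x * p) := by
      have h : 4 / s * (s ^ 2 - x * p) ≥ 4 / s * (s ^ 2 - s) := by
        gcongr
      have h' : 4 / s * (s ^ 2 - s) = 4 * s - 4 := by field_simp
      rw [add_mul, one_mul]
      linarith
    refine le_of_mul_le_mul_right ?_ hPpos
    rw [← hrel]
    calc _ ≤ B * ((1 + 4 / s) * (s ^ 2 - x * p)) := by gcongr
      _ = _ := by ring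

/-- For `N` Binomial(M, p) with `M = n^{1+α}` and `I` the one-standard-deviation
interval around `Mp`, there is a constant `c(r,p) > 0`, independent of `n`, such that
for `n` large enough the conditional `r`-th central moment satisfies
`M_r(N | N ∈ I) ≥ c(r,p) n^{r(1+α)/2}`. -/
theorem stmt15
    {Ω : Type*} [MeasurableSpace Ω] (μ : Measure Ω) [IsProbabilityMeasure μ]
    (α p r : ℝ) (hα : 0 < α) (hp : p ∈ Ioo (0 : ℝ) 1) (hr : 1 ≤ r)
    (N : ℕ → Ω → ℕ) (hmeas : ∀ n, Measurable (N n))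
    (hbinom : ∀ n k : ℕ,
      μ {ω | N n ω = k} =
        ENNReal.ofReal
          ((⌊(n : ℝ) ^ (1 + α)⌋₊.choose k : ℝ) * p ^ k *
            (1 - p) ^ (⌊(n : ℝ) ^ (1 + α)⌋₊ - k))) :
    ∃ c > (0 : ℝ), ∃ n₀ : ℕ, ∀ n ≥ n₀,
      (∫ ω in {ω | (N n ω : ℝ) ∈
            Ioo ((⌊(n : ℝ) ^ (1 + α)⌋₊ : ℝ) * p -
                Real.sqrt ((⌊(n : ℝ) ^ (1 + α)⌋₊ : ℝ) * p * (1 - p)))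
              ((⌊(n : ℝ) ^ (1 + α)⌋₊ : ℝ) * p +
                Real.sqrt ((⌊(n : ℝ) ^ (1 + α)⌋₊ : ℝ) * p * (1 - p)))},
          |(N n ω : ℝ) -
              (∫ ω' in {ω' | (N n ω' : ℝ) ∈
                  Ioo ((⌊(n : ℝ) ^ (1 + α)⌋₊ : ℝ) * p -
                      Real.sqrt ((⌊(n : ℝ) ^ (1 + α)⌋₊ : ℝ) * p * (1 - p)))
                    ((⌊(n : ℝ) ^ (1 + α)⌋₊ : ℝ) * p +
                      Real.sqrt ((⌊(n : ℝ) ^ (1 + α)⌋₊ : ℝ) * p * (1 - p)))},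
                  (N n ω' : ℝ) ∂μ) /
                (μ {ω' | (N n ω' : ℝ) ∈
                  Ioo ((⌊(n : ℝ) ^ (1 + α)⌋₊ : ℝ) * p -
                      Real.sqrt ((⌊(n : ℝ) ^ (1 + α)⌋₊ : ℝ) * p * (1 - p)))
                    ((⌊(n : ℝ) ^ (1 + α)⌋₊ : ℝ) * p +
                      Real.sqrt ((⌊(n : ℝ) ^ (1 + α)⌋₊ : ℝ) * p * (1 - p)))}).toReal| ^ r
            ∂μ) /
          (μ {ω | (N n ω : ℝ) ∈
            Ioo ((⌊(n : ℝ) ^ (1 + α)⌋₊ : ℝ) * p -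
                Real.sqrt ((⌊(n : ℝ) ^ (1 + α)⌋₊ : ℝ) * p * (1 - p)))
              ((⌊(n : ℝ) ^ (1 + α)⌋₊ : ℝ) * p +
                Real.sqrt ((⌊(n : ℝ) ^ (1 + α)⌋₊ : ℝ) * p * (1 - p)))}).toReal ≥
        c * (n : ℝ) ^ (r * (1 + α) / 2) := by
  obtain ⟨hp0, hp1⟩ := hp
  have hq : 0 < 1 - p := by linarith
  have hpq : 0 < p * (1 - p) := mul_pos hp0 hq
  refine ⟨(p * (1 - p) / 8) ^ (r / 2) / (4 * (exp 8) ^ 2), by positivity, ?_⟩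
  obtain ⟨n₀, hn₀⟩ := exists_nat_ge (max 2 (32 / (p * (1 - p))))
  refine ⟨n₀, fun n hn => ?_⟩
  have hn' : (n₀ : ℝ) ≤ n := by exact_mod_cast hn
  have hn2 : (2 : ℝ) ≤ n := (le_max_left _ _).trans (hn₀.trans hn')
  have hn3 : 32 / (p * (1 - p)) ≤ n := (le_max_right _ _).trans (hn₀.trans hn')
  have hb := hbinom n
  set T := (n : ℝ) ^ (1 + α) with hT
  have hTn : (n : ℝ) ≤ T := by
    rw [hT]
    exact Real.self_le_rpow_of_one_le (by linarith) (by linarith)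
  set M := ⌊T⌋₊ with hM
  have hMT : T / 2 ≤ M := by linarith [Nat.lt_floor_add_one T]
  set s := Real.sqrt ((M : ℝ) * p * (1 - p)) with hs
  have hs2 : s ^ 2 = M * p * (1 - p) := Real.sq_sqrt (by positivity)
  have hs2T : T / 2 * (p * (1 - p)) ≤ s ^ 2 := by
    rw [hs2, mul_assoc]; gcongr
  have hs4 : 4 ≤ s := by
    apply Real.le_sqrt_of_sq_le
    rw [← hs2]
    have : 32 ≤ T * (p * (1 - p)) := by
      rw [div_le_iff₀ hpq] at hn3
      exact hn3.trans (by gcongr)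
    linarith
  have hss : s ≤ s ^ 2 := by nlinarith
  have hMp0 : 0 ≤ (M : ℝ) * p := by positivity
  have hL : 0 ≤ (M : ℝ) * p - s := by nlinarith
  have hUM : (M : ℝ) * p + s ≤ M := by
    have : 0 ≤ (M : ℝ) * (1 - p) := by positivity
    nlinarith
  have hw : ∀ k, μ.real {ω | N n ω = k} = (M.choose k : ℝ) * p ^ k * (1 - p) ^ (M - k) := by
    intro k
    rw [measureReal_def, hb k, ENNReal.toReal_ofReal (by positivity)]
  have hpos : ∀ k : ℕ, (k : ℝ) ∈ Ioo ((M : ℝ) * p - s) ((M : ℝ) * p + s) →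
      0 < μ.real {ω | N n ω = k} := by
    intro k hk
    rw [hw]
    have hkM : k ≤ M := by
      have : (k : ℝ) ≤ M := by linarith [hk.2]
      exact_mod_cast this
    have := Nat.choose_pos hkM
    positivity
  have hU : (M : ℝ) * p + s = ((M : ℝ) * p - s) + 2 * s := by ring
  have hratio := aux_chain (fun k => μ.real {ω | N n ω = k}) _ _ s hs4 hU hpos (by
    intro k hk hk'
    simp only [hw]
    refine aux_step M k p s ⟨hp0, hp1⟩ hs4 hs2 hk.1 hk.2 ?_
    have : ((k + 1 : ℕ) : ℝ) ≤ M := by linarith [hk'.2]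
    exact_mod_cast this)
  refine ge_iff_le.2 (le_trans ?_ (aux_measure μ (N n) (hmeas n) _ _ s _ r (exp 8) hL hs4 hU hr
    (exp_pos 8) hpos hratio))
  rw [div_mul_eq_mul_div]
  gcongr
  have hT0 : 0 ≤ T := by positivity
  have e1 : (n : ℝ) ^ (r * (1 + α) / 2) = T ^ (r / 2) := by
    rw [hT, ← Real.rpow_mul (by positivity)]; ring_nf
  have e2 : (s / 2) ^ r = ((s / 2) ^ 2) ^ (r / 2) := by
    rw [← Real.rpow_natCast, ← Real.rpow_mul (by positivity)]
    congr 1; push_cast; ring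
  rw [e1, e2, ← Real.mul_rpow (by positivity) hT0]
  apply Real.rpow_le_rpow (by positivity) _ (by linarith)
  nlinarith
end
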